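/- Let H = ℚ[c₁, c₂, ...] be the Hopf algebra modeling H*(BU;ℚ), and let proj : H → H^{≥2d} be the projection killing degrees < 2d, and i* : H → ℚ[c₁,...,c_d] the quotient by ⟨c_{d+1}, c_{d+2}, ...⟩. Then the kernels of the maps (1 ⊗ (i* ∘ proj)) ∘ Δ̄ and (1 ⊗ proj) ∘ Δ̄ on H coincide. -/

import Mathlib

/- H = ℚ[c₁, c₂, ...] modeling H^*(BU;ℚ) (`X n` = c_{n+1}, degree 2(n+1)), with
coproduct Δ(cₙ) = Σᵢ cᵢ ⊗ c_{n−i} and reduced coproduct Δ̄.  Let proj = id − (sum of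
weighted homogeneous components of degree < 2d), projecting onto degrees ≥ 2d, and
i* : H → ℚ[c₁,...,c_d] the quotient by ⟨c_{d+1},...⟩.  The kernels of
(1 ⊗ (i* ∘ proj)) ∘ Δ̄ and (1 ⊗ proj) ∘ Δ̄ coincide. -/

open MvPolynomial TensorProduct

noncomputable section

abbrev H : Type := MvPolynomial ℕ ℚ

def wBU (i : ℕ) : ℕ := 2 * (i + 1)

def comulBU : H →ₐ[ℚ] H ⊗[ℚ] H :=
  aeval fun n => X n ⊗ₜ[ℚ] 1 + 1 ⊗ₜ[ℚ] X n + ∑ i ∈ Finset.range n, X i ⊗ₜ[ℚ] X (n - 1 - i)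

/-- The reduced coproduct, as a linear map. -/
def Dbar : H →ₗ[ℚ] H ⊗[ℚ] H :=
  comulBU.toLinearMap - (TensorProduct.mk ℚ H H).flip 1 - TensorProduct.mk ℚ H H 1

/-- Projection onto the part of degree ≥ 2d. -/
def projGE (d : ℕ) : H →ₗ[ℚ] H :=
  LinearMap.id - ∑ n ∈ Finset.range (2 * d), weightedHomogeneousComponent wBU n

/-- Restriction to `BU(d)`: the quotient killing c_j for j > d. -/
def istar (d : ℕ) : H →ₐ[ℚ] MvPolynomial (Fin d) ℚ :=
  aeval fun j => if h : j < d then X ⟨j, h⟩ else 0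

/-- The class `cₙ`, with the convention `c₀ = 1`. -/
def chern : ℕ → H
  | 0 => 1
  | n + 1 => X n

/-- The derivation `cₙ ↦ cₙ₋ₖ`, dual to the primitive class of degree `2k`. -/
def primDer (k : ℕ) : Derivation ℚ H H :=
  mkDerivation ℚ fun n => if k ≤ n + 1 then chern (n + 1 - k) else 0

theorem primDer_X (k n : ℕ) :
    primDer k (X n) = if k ≤ n + 1 then chern (n + 1 - k) else 0 :=
  mkDerivation_X _ _ _

theorem primDer_chern {k : ℕ} (hk : 1 ≤ k) (n : ℕ) :
    primDer k (chern n) = if k ≤ n then chern (n - k) else 0 := by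
  cases n with
  | zero => rw [if_neg (by omega)]; exact (primDer k).map_one_eq_zero
  | succ n => exact primDer_X k n

theorem comulBU_chern (n : ℕ) :
    comulBU (chern n) = ∑ i ∈ Finset.range (n + 1), chern i ⊗ₜ[ℚ] chern (n - i) := by
  cases n with
  | zero => simp [chern, Algebra.TensorProduct.one_def]
  | succ n =>
    rw [Finset.sum_range_succ, Finset.sum_range_succ']
    simp only [comulBU, chern, aeval_X, Nat.sub_zero, Nat.sub_self]
    rw [add_comm (_ ⊗ₜ[ℚ] _) (_ ⊗ₜ[ℚ] _), add_comm _ (∑ _ ∈ _, _), add_assoc]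
    congr 1
    refine Finset.sum_congr rfl fun i hi => ?_
    have hi := Finset.mem_range.mp hi
    rw [show n + 1 - (i + 1) = (n - 1 - i) + 1 by omega]

theorem rTensor_derivation_mul (D : Derivation ℚ H H) (a b : H ⊗[ℚ] H) :
    LinearMap.rTensor H D.toLinearMap (a * b) =
      a * LinearMap.rTensor H D.toLinearMap b + b * LinearMap.rTensor H D.toLinearMap a := by
  induction a with
  | zero => simp
  | add a₁ a₂ h₁ h₂ => simp only [add_mul, map_add, mul_add, h₁, h₂]; abel
  | tmul p q =>
    induction b with
    | zero => simp
    | add b₁ b₂ h₁ h₂ => simp only [add_mul, map_add, mul_add, h₁, h₂]; abel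
    | tmul r s => simp [TensorProduct.add_tmul, mul_comm]

theorem lTensor_derivation_mul (D : Derivation ℚ H H) (a b : H ⊗[ℚ] H) :
    LinearMap.lTensor H D.toLinearMap (a * b) =
      a * LinearMap.lTensor H D.toLinearMap b + b * LinearMap.lTensor H D.toLinearMap a := by
  induction a with
  | zero => simp
  | add a₁ a₂ h₁ h₂ => simp only [add_mul, map_add, mul_add, h₁, h₂]; abel
  | tmul p q =>
    induction b with
    | zero => simp
    | add b₁ b₂ h₁ h₂ => simp only [add_mul, map_add, mul_add, h₁, h₂]; abel
    | tmul r s => simp [TensorProduct.tmul_add, mul_comm]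

theorem primDer_comulBU_chern {k : ℕ} (hk : 1 ≤ k) (n : ℕ) :
    LinearMap.rTensor H (primDer k).toLinearMap (comulBU (chern n)) =
      LinearMap.lTensor H (primDer k).toLinearMap (comulBU (chern n)) := by
  simp only [comulBU_chern, map_sum, LinearMap.rTensor_tmul, LinearMap.lTensor_tmul,
    Derivation.coeFn_coe, primDer_chern hk]
  rcases lt_or_ge n k with h | h
  · rw [Finset.sum_eq_zero, Finset.sum_eq_zero]
    · intro i hi
      rw [if_neg (by omega), TensorProduct.tmul_zero]
    · intro i hi
      rw [if_neg (by have := Finset.mem_range.mp hi; omega), TensorProduct.zero_tmul]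
  · obtain ⟨m, rfl⟩ := Nat.exists_eq_add_of_le h
    conv_lhs => rw [add_assoc, Finset.sum_range_add]
    conv_rhs => rw [show k + m + 1 = (m + 1) + k by omega, Finset.sum_range_add]
    rw [Finset.sum_eq_zero, zero_add, Finset.sum_eq_zero (s := Finset.range k), add_zero]
    · refine Finset.sum_congr rfl fun i hi => ?_
      have hi := Finset.mem_range.mp hi
      rw [if_pos (by omega), if_pos (by omega)]
      congr 2 <;> omega
    · intro i hi
      rw [if_neg (by omega), TensorProduct.tmul_zero]
    · intro i hi
      rw [if_neg (by have := Finset.mem_range.mp hi; omega), TensorProduct.zero_tmul]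

theorem primDer_comulBU {k : ℕ} (hk : 1 ≤ k) (x : H) :
    LinearMap.rTensor H (primDer k).toLinearMap (comulBU x) =
      LinearMap.lTensor H (primDer k).toLinearMap (comulBU x) := by
  induction x using MvPolynomial.induction_on with
  | C a =>
    rw [← algebraMap_eq, AlgHom.commutes, Algebra.TensorProduct.algebraMap_apply,
      LinearMap.rTensor_tmul, LinearMap.lTensor_tmul]
    simp
  | add p q hp hq => rw [map_add, map_add, map_add, hp, hq]
  | mul_X p n hp =>
    rw [map_mul, rTensor_derivation_mul, lTensor_derivation_mul, hp]
    have := primDer_comulBU_chern hk (n + 1)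
    rw [chern] at this
    rw [this]

theorem weightedHomogeneousComponent_comm {σ τ : Type*} {w : σ → ℕ} {w' : τ → ℕ} {s : ℕ}
    (f : MvPolynomial σ ℚ →ₗ[ℚ] MvPolynomial τ ℚ)
    (hf : ∀ m r e, coeff e (f (monomial m r)) ≠ 0 →
      Finsupp.weight w' e + s = Finsupp.weight w m)
    (n : ℕ) (p : MvPolynomial σ ℚ) :
    weightedHomogeneousComponent w' n (f p) = f (weightedHomogeneousComponent w (n + s) p) := by
  induction p using MvPolynomial.induction_on' with
  | add p q hp hq => simp only [map_add, hp, hq]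
  | monomial m r =>
    rw [weightedHomogeneousComponent_of_mem (n := Finsupp.weight w m)
      (isWeightedHomogeneous_monomial w m r rfl)]
    split_ifs with h
    · refine IsWeightedHomogeneous.weightedHomogeneousComponent_same fun e he => ?_
      have := hf m r e he
      omega
    · rw [map_zero]
      refine weightedHomogeneousComponent_eq_zero' _ _ fun e he => ?_
      have := hf m r e (mem_support_iff.mp he)
      omega

theorem isWeightedHomogeneous_chern (n : ℕ) : IsWeightedHomogeneous wBU (chern n) (2 * n) := by
  cases n with
  | zero => exact isWeightedHomogeneous_one _ _
  | succ n => exact isWeightedHomogeneous_X _ _ _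

theorem weightedHomogeneousComponent_primDer (k n : ℕ) (p : H) :
    weightedHomogeneousComponent wBU n (primDer k p) =
      primDer k (weightedHomogeneousComponent wBU (n + 2 * k) p) := by
  refine weightedHomogeneousComponent_comm (primDer k).toLinearMap (fun m r e he => ?_) n p
  rw [Derivation.coeFn_coe, primDer, mkDerivation_monomial,
    coeff_smul, Finsupp.sum, coeff_sum] at he
  obtain ⟨i, hi, he⟩ := Finset.exists_ne_zero_of_sum_ne_zero (right_ne_zero_of_mul he)
  split_ifs at he with hk
  · have hle : Finsupp.single i 1 ≤ m := by
      rw [Finsupp.single_le_iff]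
      exact Nat.one_le_iff_ne_zero.mpr (Finsupp.mem_support_iff.mp hi)
    have h := ((isWeightedHomogeneous_monomial wBU (m - Finsupp.single i 1) ((m i : ℕ) : ℚ) rfl).mul
      (isWeightedHomogeneous_chern (i + 1 - k))) he
    have hm := congrArg (Finsupp.weight wBU) (tsub_add_cancel_of_le hle)
    rw [map_add, Finsupp.weight_single, wBU, one_smul] at hm
    omega
  · simp at he

theorem weightedHomogeneousComponent_istar (d n : ℕ) (p : H) :
    weightedHomogeneousComponent (fun j : Fin d => wBU j) n (istar d p) =
      istar d (weightedHomogeneousComponent wBU n p) := by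
  refine weightedHomogeneousComponent_comm (s := 0) (istar d).toLinearMap (fun m r e he => ?_) n p
  rw [AlgHom.toLinearMap_apply, istar, aeval_monomial, algebraMap_eq, coeff_C_mul] at he
  have hX : ∀ j, IsWeightedHomogeneous (fun j : Fin d => wBU j)
      (if h : j < d then X ⟨j, h⟩ else 0 : MvPolynomial (Fin d) ℚ) (wBU j) := by
    intro j
    split_ifs with h
    · exact isWeightedHomogeneous_X _ _ _
    · exact isWeightedHomogeneous_zero _ _ _
  have h := IsWeightedHomogeneous.prod m.support _ _ (fun j _ => (hX j).pow (m j))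
    (right_ne_zero_of_mul he)
  rw [add_zero, h, Finsupp.weight_apply, Finsupp.sum]

theorem weightedHomogeneousComponent_projGE {d n : ℕ} (hn : 2 * d ≤ n) (p : H) :
    weightedHomogeneousComponent wBU n (projGE d p) = weightedHomogeneousComponent wBU n p := by
  rw [projGE, LinearMap.sub_apply, LinearMap.sum_apply, map_sub, map_sum, Finset.sum_eq_zero,
    sub_zero, LinearMap.id_apply]
  intro i hi
  exact IsWeightedHomogeneous.weightedHomogeneousComponent_ne n
    (weightedHomogeneousComponent_isWeightedHomogeneous i p)
    (by have := Finset.mem_range.mp hi; omega)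

theorem projGE_eq_zero {d : ℕ} {p : H}
    (h : ∀ n, 2 * d ≤ n → weightedHomogeneousComponent wBU n p = 0) : projGE d p = 0 := by
  ext m
  rcases lt_or_ge (Finsupp.weight wBU m) (2 * d) with hm | hm
  · simp [projGE, coeff_sum, coeff_weightedHomogeneousComponent, hm]
  · have := congrArg (coeff m) ((weightedHomogeneousComponent_projGE hm p).trans (h _ hm))
    rwa [coeff_weightedHomogeneousComponent, if_pos rfl] at this

theorem projGE_C {d : ℕ} (hd : 1 ≤ d) (a : ℚ) : projGE d (C a) = 0 :=
  projGE_eq_zero fun n hn =>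
    (isWeightedHomogeneous_C wBU a).weightedHomogeneousComponent_ne n (by omega)

theorem istar_weightedHomogeneousComponent_eq_zero {d n : ℕ} {p : H} (hn : 2 * d ≤ n)
    (h : istar d (projGE d p) = 0) : istar d (weightedHomogeneousComponent wBU n p) = 0 := by
  rw [← weightedHomogeneousComponent_projGE hn, ← weightedHomogeneousComponent_istar, h, map_zero]

theorem wBU_le_of_mem_vars {n j : ℕ} {g : H} (hg : IsWeightedHomogeneous wBU g n)
    (hj : j ∈ g.vars) : 2 * (j + 1) ≤ n := by
  obtain ⟨m, hm, hjm⟩ := (mem_vars_iff_mem_support j).mp hj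
  rw [← hg (mem_support_iff.mp hm)]
  exact Finsupp.le_weight_of_ne_zero' wBU (Finsupp.mem_support_iff.mp hjm)

theorem eq_zero_of_istar_eq_zero {d n : ℕ} {g : H} (hg : IsWeightedHomogeneous wBU g n)
    (hn : n < 2 * (d + 1)) (h : istar d g = 0) : g = 0 := by
  have key : ((rename Fin.val : MvPolynomial (Fin d) ℚ →ₐ[ℚ] H).comp (istar d)).toRingHom g =
      (AlgHom.id ℚ H).toRingHom g := by
    refine hom_congr_vars (by ext; simp) (fun i hi _ => ?_) rfl
    have := wBU_le_of_mem_vars hg hi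
    simp [istar, show i < d by omega]
  simpa [h] using key.symm

theorem istar_pderiv {d j : ℕ} (hj : j < d) (g : H) :
    istar d (pderiv j g) = pderiv ⟨j, hj⟩ (istar d g) := by
  induction g using MvPolynomial.induction_on with
  | C a => simp [← algebraMap_eq]
  | add p q hp hq => simp only [map_add, hp, hq]
  | mul_X p i hp =>
    simp only [pderiv_mul, map_add, map_mul, hp]
    congr 2
    by_cases hi : i < d
    · simp only [istar, aeval_X, hi, dif_pos, pderiv_X, Pi.single_apply, Fin.mk.injEq]
      split_ifs <;> simp
    · rw [pderiv_X_of_ne (by omega)]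
      simp [istar, hi]

theorem istar_chern_of_lt {d n : ℕ} (h : d < n) : istar d (chern n) = 0 := by
  obtain ⟨m, rfl⟩ := Nat.exists_eq_succ_of_ne_zero (by omega : n ≠ 0)
  simp [chern, istar, show ¬ m < d by omega]

theorem istar_chern_self_ne_zero (d : ℕ) : istar d (chern d) ≠ 0 := by
  cases d with
  | zero => simp [chern]
  | succ d => simp [chern, istar]

theorem pderiv_eq_zero_of_isWeightedHomogeneous {n j : ℕ} {g : H}
    (hg : IsWeightedHomogeneous wBU g n) (hj : n < 2 * (j + 1)) : pderiv j g = 0 :=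
  pderiv_eq_zero_of_notMem_vars fun h => by
    have := wBU_le_of_mem_vars hg h
    omega

theorem derivation_sum_apply (s : Finset ℕ) (D : ℕ → Derivation ℚ H H) (g : H) :
    (∑ j ∈ s, D j) g = ∑ j ∈ s, D j g := by
  rw [← Derivation.coeFnAddMonoidHom_apply, map_sum, Finset.sum_apply]
  rfl

theorem primDer_eq_sum {n : ℕ} {g : H} (hg : IsWeightedHomogeneous wBU g n) (k : ℕ) :
    primDer k g = ∑ j ∈ Finset.range n, primDer k (X j) * pderiv j g := by
  have : primDer k g =
      (∑ j ∈ Finset.range n, primDer k (X j) • pderiv j : Derivation ℚ H H) g := by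
    refine derivation_eq_of_forall_mem_vars fun i hi => ?_
    have := wBU_le_of_mem_vars hg hi
    rw [derivation_sum_apply, Finset.sum_eq_single i]
    · simp
    · intro j _ hj
      rw [Derivation.smul_apply, pderiv_X_of_ne hj.symm, smul_zero]
    · intro h
      exact absurd (Finset.mem_range.mpr (by omega)) h
  rw [this, derivation_sum_apply]
  rfl

theorem eq_zero_of_pderiv_eq_zero {n : ℕ} (hn : 0 < n) {g : H}
    (hg : IsWeightedHomogeneous wBU g n) (h : ∀ j, pderiv j g = 0) : g = 0 := by
  ext m
  by_contra hm
  have hw := hg hm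
  obtain ⟨j, hj⟩ : ∃ j, m j ≠ 0 := by
    by_contra! h0
    obtain rfl : m = 0 := Finsupp.ext h0
    simp at hw
    omega
  have hle : Finsupp.single j 1 ≤ m := by
    rw [Finsupp.single_le_iff]
    exact Nat.one_le_iff_ne_zero.mpr hj
  have hc := coeff_pderiv g (i := j) (m - Finsupp.single j 1)
  rw [h j, tsub_add_cancel_of_le hle, coeff_zero] at hc
  rcases mul_eq_zero.mp hc.symm with h' | h'
  · exact hm h'
  · exact absurd h' (by positivity)

theorem eq_zero_of_primDer_eq_zero {n : ℕ} (hn : 0 < n) {g : H}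
    (hg : IsWeightedHomogeneous wBU g n) (h : ∀ k, 1 ≤ k → primDer k g = 0) : g = 0 := by
  have key : ∀ t j, n ≤ j + t → pderiv j g = 0 := by
    intro t
    induction t with
    | zero => exact fun j hj => pderiv_eq_zero_of_isWeightedHomogeneous hg (by omega)
    | succ t ih =>
      intro j hj
      rcases le_or_gt n j with hnj | hnj
      · exact pderiv_eq_zero_of_isWeightedHomogeneous hg (by omega)
      have hs := primDer_eq_sum hg (j + 1)
      rw [h _ (by omega), Finset.sum_eq_single j] at hs
      · simpa [primDer_X, chern] using hs.symm
      · intro i _ hi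
        rcases lt_or_gt_of_ne hi with hi | hi
        · rw [primDer_X, if_neg (by omega), zero_mul]
        · rw [ih i (by omega), mul_zero]
      · exact fun h' => absurd (Finset.mem_range.mpr hnj) h'
  exact eq_zero_of_pderiv_eq_zero hn hg fun j => key n j (by omega)

/-- The recurrence `∑ᵢ cᵢ v_{k+i} = 0` for `v_j = i*(∂g/∂c_j)` propagates the vanishing of the
first `d` terms, as its leading coefficient `c_d` is a nonzerodivisor on `BU(d)`. -/
theorem istar_pderiv_eq_zero {d n : ℕ} {g : H} (hg : IsWeightedHomogeneous wBU g n)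
    (h : istar d g = 0) (hD : ∀ k, 1 ≤ k → 2 * d + 2 * k ≤ n → primDer k g = 0) (j : ℕ) :
    istar d (pderiv j g) = 0 := by
  induction j using Nat.strong_induction_on with
  | _ j ih =>
    rcases lt_or_ge j d with hj | hj
    · rw [istar_pderiv hj, h, map_zero]
    rcases lt_or_ge n (2 * (j + 1)) with hn | hn
    · rw [pderiv_eq_zero_of_isWeightedHomogeneous hg hn, map_zero]
    have hs := congrArg (istar d) (primDer_eq_sum hg (j + 1 - d))
    rw [hD _ (by omega) (by omega), map_zero, map_sum, Finset.sum_eq_single j] at hs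
    · rw [map_mul, primDer_X, if_pos (by omega), show j + 1 - (j + 1 - d) = d by omega] at hs
      exact (mul_eq_zero.mp hs.symm).resolve_left (istar_chern_self_ne_zero d)
    · intro i _ hi
      rw [map_mul]
      rcases lt_or_gt_of_ne hi with hi | hi
      · rw [ih i hi, mul_zero]
      · rw [primDer_X, if_pos (by omega), istar_chern_of_lt (by omega), zero_mul]
    · exact fun h' => absurd (Finset.mem_range.mpr (by omega)) h'

theorem projGE_eq_zero_of_istar {d : ℕ} (hd : 1 ≤ d) (V : Set H)
    (hV : ∀ k, 1 ≤ k → ∀ v ∈ V, primDer k v ∈ V)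
    (h : ∀ v ∈ V, istar d (projGE d v) = 0) {v : H} (hv : v ∈ V) : projGE d v = 0 := by
  refine projGE_eq_zero fun n hn => ?_
  induction n using Nat.strong_induction_on generalizing v with
  | _ n ih =>
    have hg := weightedHomogeneousComponent_isWeightedHomogeneous (w := wBU) n v
    have hcomp : ∀ k, 2 * k ≤ n → primDer k (weightedHomogeneousComponent wBU n v) =
        weightedHomogeneousComponent wBU (n - 2 * k) (primDer k v) := by
      intro k hk
      rw [weightedHomogeneousComponent_primDer, Nat.sub_add_cancel hk]
    have hD : ∀ k, 1 ≤ k → 2 * d + 2 * k ≤ n →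
        primDer k (weightedHomogeneousComponent wBU n v) = 0 := by
      intro k hk hkn
      rw [hcomp k (by omega)]
      exact ih _ (by omega) (hV k hk v hv) (by omega)
    have hp := istar_pderiv_eq_zero hg (istar_weightedHomogeneousComponent_eq_zero hn (h v hv)) hD
    refine eq_zero_of_primDer_eq_zero (by omega) hg fun k hk => ?_
    have hi : istar d (primDer k (weightedHomogeneousComponent wBU n v)) = 0 := by
      rw [primDer_eq_sum hg, map_sum]
      exact Finset.sum_eq_zero fun j _ => by rw [map_mul, hp, mul_zero]
    rcases le_or_gt (2 * d + 2 * k) n with hkn | hkn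
    · exact hD k hk hkn
    rcases le_or_gt (2 * k) n with hkn' | hkn'
    · rw [hcomp k hkn'] at hi ⊢
      exact eq_zero_of_istar_eq_zero (weightedHomogeneousComponent_isWeightedHomogeneous _ _)
        (by omega) hi
    · refine derivation_eq_zero_of_forall_mem_vars fun j hj => ?_
      have := wBU_le_of_mem_vars hg hj
      rw [primDer_X, if_neg (by omega)]

/-- The contraction of the left tensor factor of the coproduct by a functional. -/
def contract (φ : H →ₗ[ℚ] ℚ) : H →ₗ[ℚ] H :=
  (TensorProduct.lid ℚ H).toLinearMap ∘ₗ LinearMap.rTensor H φ ∘ₗ comulBU.toLinearMap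

theorem primDer_contract {k : ℕ} (hk : 1 ≤ k) (φ : H →ₗ[ℚ] ℚ) (x : H) :
    primDer k (contract φ x) = contract (φ ∘ₗ (primDer k).toLinearMap) x := by
  have h : ∀ z : H ⊗[ℚ] H, primDer k (TensorProduct.lid ℚ H (LinearMap.rTensor H φ z)) =
      TensorProduct.lid ℚ H
        (LinearMap.rTensor H φ (LinearMap.lTensor H (primDer k).toLinearMap z)) := by
    intro z
    induction z with
    | zero => simp
    | add a b ha hb => simp only [map_add, ha, hb]
    | tmul p q => simp
  have hx := h (comulBU x)
  rw [← primDer_comulBU hk, ← LinearMap.rTensor_comp_apply] at hx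
  exact hx

theorem lid_rTensor_map {B : Type*} [AddCommGroup B] [Module ℚ B] (φ : H →ₗ[ℚ] ℚ)
    (F : H →ₗ[ℚ] B) (z : H ⊗[ℚ] H) :
    TensorProduct.lid ℚ B (LinearMap.rTensor B φ (TensorProduct.map LinearMap.id F z)) =
      F (TensorProduct.lid ℚ H (LinearMap.rTensor H φ z)) := by
  induction z with
  | zero => simp
  | add a b ha hb => simp only [map_add, ha, hb]
  | tmul p q => simp

theorem lid_rTensor_Dbar (φ : H →ₗ[ℚ] ℚ) (x : H) :
    TensorProduct.lid ℚ H (LinearMap.rTensor H φ (Dbar x)) =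
      contract φ x - C (φ x) - φ 1 • x := by
  simp [Dbar, contract, C_eq_smul_one]

theorem contract_counit (x : H) : contract (aeval fun _ => (0 : ℚ)).toLinearMap x = x := by
  have : (((Algebra.TensorProduct.lid ℚ H).toAlgHom.comp
      (Algebra.TensorProduct.map (aeval fun _ => (0 : ℚ)) (AlgHom.id ℚ H))).comp comulBU) =
      AlgHom.id ℚ H := by
    ext n : 1
    simp [comulBU]
  exact DFunLike.congr_fun this x

theorem eq_zero_of_forall_lid_rTensor {B : Type*} [AddCommGroup B] [Module ℚ B] (z : H ⊗[ℚ] B)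
    (h : ∀ φ : H →ₗ[ℚ] ℚ, TensorProduct.lid ℚ B (LinearMap.rTensor B φ z) = 0) : z = 0 := by
  let b := MvPolynomial.basisMonomials ℕ ℚ
  apply (TensorProduct.equivFinsuppOfBasisLeft b).injective
  ext i
  rw [map_zero, Finsupp.zero_apply, ← h (b.coord i)]
  clear h
  induction z with
  | zero => simp
  | add p q hp hq => simp only [map_add, Finsupp.add_apply, hp, hq]
  | tmul p q => simp

theorem kernels_coincide (d : ℕ) (hd : 1 ≤ d) (x : H) :
    TensorProduct.map LinearMap.id ((istar d).toLinearMap ∘ₗ projGE d) (Dbar x) = 0 ↔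
      TensorProduct.map LinearMap.id (projGE d) (Dbar x) = 0 := by
  constructor
  · intro h
    have hφ : ∀ φ : H →ₗ[ℚ] ℚ, φ 1 = 0 → istar d (projGE d (contract φ x)) = 0 := by
      intro φ h1
      have := lid_rTensor_map φ ((istar d).toLinearMap ∘ₗ projGE d) (Dbar x)
      rw [h, lid_rTensor_Dbar, h1, zero_smul, sub_zero, map_sub, LinearMap.comp_apply,
        LinearMap.comp_apply, projGE_C hd] at this
      simpa using this.symm
    have hproj : ∀ φ : H →ₗ[ℚ] ℚ, φ 1 = 0 → projGE d (contract φ x) = 0 := by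
      intro φ h1
      refine projGE_eq_zero_of_istar hd {v | ∃ φ : H →ₗ[ℚ] ℚ, φ 1 = 0 ∧ contract φ x = v}
        ?_ ?_ ⟨φ, h1, rfl⟩
      · rintro k hk _ ⟨ψ, hψ, rfl⟩
        exact ⟨_, by simp, (primDer_contract hk ψ x).symm⟩
      · rintro _ ⟨ψ, hψ, rfl⟩
        exact hφ ψ hψ
    refine eq_zero_of_forall_lid_rTensor _ fun φ => ?_
    rw [lid_rTensor_map, lid_rTensor_Dbar, map_sub, map_sub, projGE_C hd, sub_zero]
    have hsplit := hproj (φ - φ 1 • (aeval fun _ => (0 : ℚ)).toLinearMap) (by simp)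
    have hc : contract (φ - φ 1 • (aeval fun _ => (0 : ℚ)).toLinearMap) x =
        contract φ x - φ 1 • x := by
      nth_rw 3 [← contract_counit x]
      simp only [contract, LinearMap.comp_apply, LinearMap.rTensor_sub, LinearMap.rTensor_smul,
        LinearMap.sub_apply, LinearMap.smul_apply, map_sub, map_smul]
    rwa [hc, map_sub] at hsplit
  · intro h
    rw [← LinearMap.id_comp (LinearMap.id : H →ₗ[ℚ] H), TensorProduct.map_comp,
      LinearMap.comp_apply, h, map_zero]

end
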